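/- Let R : ℝ² → ℝ² be the rotation by π/2 about Z = (1/2, 1/2), i.e. R(x,y) = (1−y, x). Then F and R commute on Q: F(R(p)) = R(F(p)) for every p ∈ Q. -/

import Mathlib

open Real Set Filter

noncomputable section

/-- A point in the plane. -/
abbrev Pt : Type := ℝ × ℝ

/-- The unit square `Q = [0,1] × [0,1]`. -/
def unitSq : Set Pt := Icc (0:ℝ) 1 ×ˢ Icc (0:ℝ) 1

/-- The corners `E₁, E₂, E₃, E₄` of the unit square (cyclically indexed). -/
def Ept : Fin 4 → Pt := ![(0,0), (1,0), (1,1), (0,1)]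

/-- The inner points `P₁, P₂, P₃, P₄` (cyclically indexed). -/
def Ppt (s t : ℝ) : Fin 4 → Pt := ![(s,t), (1-t,s), (1-s,1-t), (t,1-s)]

/-- The image points `P₁′, P₂′, P₃′, P₄′` (cyclically indexed). -/
def Ppt' (s t : ℝ) : Fin 4 → Pt := ![(1-s,t), (1-t,1-s), (s,1-t), (t,s)]

/-- The triangle `𝒜ᵢ = conv {Eᵢ, Eᵢ₊₁, Pᵢ}`. -/
def Apiece (s t : ℝ) (i : Fin 4) : Set Pt :=
  convexHull ℝ {Ept i, Ept (i+1), Ppt s t i}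

/-- The triangle `ℬᵢ = conv {Eᵢ, Pᵢ, Pᵢ₋₁}`. -/
def Bpiece (s t : ℝ) (i : Fin 4) : Set Pt :=
  convexHull ℝ {Ept i, Ppt s t i, Ppt s t (i-1)}

/-- The central square `𝒞 = conv {P₁, P₂, P₃, P₄}`. -/
def Cpiece (s t : ℝ) : Set Pt :=
  convexHull ℝ {Ppt s t 0, Ppt s t 1, Ppt s t 2, Ppt s t 3}

/-- `F : Q → Q` is continuous, affine on each of the nine pieces, fixes the
corners `Eᵢ` and maps `Pᵢ` to `Pᵢ′`. -/
def IsPAMap (s t : ℝ) (F : Pt → Pt) : Prop :=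
  MapsTo F unitSq unitSq ∧
  ContinuousOn F unitSq ∧
  (∀ i : Fin 4, ∃ g : Pt →ᵃ[ℝ] Pt, EqOn F g (Apiece s t i)) ∧
  (∀ i : Fin 4, ∃ g : Pt →ᵃ[ℝ] Pt, EqOn F g (Bpiece s t i)) ∧
  (∃ g : Pt →ᵃ[ℝ] Pt, EqOn F g (Cpiece s t)) ∧
  (∀ i : Fin 4, F (Ept i) = Ept i) ∧
  (∀ i : Fin 4, F (Ppt s t i) = Ppt' s t i)

/-- The rotation by `π/2` about `Z = (1/2, 1/2)`. -/
def Rmap : Pt → Pt := fun p => (1 - p.2, p.1)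

/-- Twice the signed area of the triangle `a b c`. -/
def cross (a b c : Pt) : ℝ := (b.1 - a.1) * (c.2 - a.2) - (b.2 - a.2) * (c.1 - a.1)

theorem mem_convexHull_of_cross {a b c p : Pt} (hD : 0 < cross a b c) (hab : 0 ≤ cross a b p)
    (hbc : 0 ≤ cross b c p) (hca : 0 ≤ cross c a p) : p ∈ convexHull ℝ {a, b, c} := by
  have hsum : cross b c p + cross c a p + cross a b p = cross a b c := by
    simp only [cross]; ring
  have key := (convex_convexHull ℝ ({a, b, c} : Set Pt)).sum_mem (t := Finset.univ)
    (w := ![cross b c p / cross a b c, cross c a p / cross a b c, cross a b p / cross a b c])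
    (z := ![a, b, c])
    (by intro i _; fin_cases i <;> simp <;> positivity)
    (by simp only [Fin.sum_univ_three, Matrix.cons_val]; rw [← add_div, ← add_div, hsum,
          div_self hD.ne'])
    (by intro i _; apply subset_convexHull; fin_cases i <;> simp)
  convert key using 1
  simp only [Fin.sum_univ_three, Matrix.cons_val]
  ext
  · simp only [Prod.fst_add, Prod.smul_fst, smul_eq_mul]
    field_simp
    simp only [cross]; ring
  · simp only [Prod.snd_add, Prod.smul_snd, smul_eq_mul]
    field_simp
    simp only [cross]; ring

/-- `Rmap` as an affine map. -/
def Raff : Pt →ᵃ[ℝ] Pt :=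
  (AffineMap.const ℝ Pt (1 : ℝ) - (LinearMap.snd ℝ ℝ ℝ).toAffineMap).prod
    (LinearMap.fst ℝ ℝ ℝ).toAffineMap

theorem coe_Raff : ⇑Raff = Rmap := by
  ext p <;> simp [Raff, Rmap]

theorem eqOn_convexHull_of_eqOn {f g : Pt →ᵃ[ℝ] Pt} {S : Set Pt} (h : EqOn f g S) :
    EqOn f g (convexHull ℝ S) := by
  refine convexHull_min (t := {x | f x = g x}) h ?_
  intro x hx y hy a b _ _ hab
  simp only [mem_ofPred_eq] at *
  rw [Convex.combo_affine_apply hab, Convex.combo_affine_apply hab, hx, hy]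

theorem Rmap_mem_convexHull {S : Set Pt} {p : Pt} (hp : p ∈ convexHull ℝ S) :
    Rmap p ∈ convexHull ℝ (Rmap '' S) := by
  rw [← coe_Raff, ← AffineMap.image_convexHull]
  exact mem_image_of_mem _ hp

theorem commutes_on_convexHull {F : Pt → Pt} {g g' : Pt →ᵃ[ℝ] Pt} {S : Set Pt}
    (hg : EqOn F g (convexHull ℝ S)) (hg' : EqOn F g' (convexHull ℝ (Rmap '' S)))
    (h : ∀ v ∈ S, F (Rmap v) = Rmap (F v)) {p : Pt} (hp : p ∈ convexHull ℝ S) :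
    F (Rmap p) = Rmap (F p) := by
  rw [hg hp, hg' (Rmap_mem_convexHull hp), ← coe_Raff]
  refine eqOn_convexHull_of_eqOn (f := g'.comp Raff) (g := Raff.comp g) (fun v hv => ?_) hp
  have hv' := subset_convexHull ℝ S hv
  simp only [AffineMap.comp_apply, coe_Raff]
  rw [← hg hv', ← hg' (Rmap_mem_convexHull hv'), h v hv]

theorem Rmap_Ept (i : Fin 4) : Rmap (Ept i) = Ept (i + 1) := by
  fin_cases i <;> simp [Rmap, Ept]

theorem Rmap_Ppt (s t : ℝ) (i : Fin 4) : Rmap (Ppt s t i) = Ppt s t (i + 1) := by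
  fin_cases i <;> simp [Rmap, Ppt]

theorem Rmap_Ppt' (s t : ℝ) (i : Fin 4) : Rmap (Ppt' s t i) = Ppt' s t (i + 1) := by
  fin_cases i <;> simp [Rmap, Ppt']

theorem convexHull_Rmap_A (s t : ℝ) (i : Fin 4) :
    convexHull ℝ (Rmap '' {Ept i, Ept (i + 1), Ppt s t i}) = Apiece s t (i + 1) := by
  simp only [image_insert_eq, image_singleton, Rmap_Ept, Rmap_Ppt, Apiece]

theorem convexHull_Rmap_B (s t : ℝ) (i : Fin 4) :
    convexHull ℝ (Rmap '' {Ept i, Ppt s t i, Ppt s t (i - 1)}) = Bpiece s t (i + 1) := by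
  simp only [image_insert_eq, image_singleton, Rmap_Ept, Rmap_Ppt, Bpiece, sub_add_cancel,
    add_sub_cancel_right]

theorem convexHull_Rmap_C (s t : ℝ) :
    convexHull ℝ (Rmap '' {Ppt s t 0, Ppt s t 1, Ppt s t 2, Ppt s t 3}) = Cpiece s t := by
  simp only [image_insert_eq, image_singleton, Rmap_Ppt, Cpiece]
  congr 1
  ext x
  simp only [mem_insert_iff, mem_singleton_iff, Fin.reduceAdd]
  tauto

/-- `p` lies in one of the nine pieces. -/
def Covered (s t : ℝ) (p : Pt) : Prop :=
  (∃ i, p ∈ Apiece s t i) ∨ (∃ i, p ∈ Bpiece s t i) ∨ p ∈ Cpiece s t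

theorem Covered.rotate {s t : ℝ} {p : Pt} (h : Covered s t p) : Covered s t (Rmap p) := by
  rcases h with ⟨i, h⟩ | ⟨i, h⟩ | h
  · exact Or.inl ⟨i + 1, convexHull_Rmap_A s t i ▸ Rmap_mem_convexHull h⟩
  · exact Or.inr (Or.inl ⟨i + 1, convexHull_Rmap_B s t i ▸ Rmap_mem_convexHull h⟩)
  · exact Or.inr (Or.inr (convexHull_Rmap_C s t ▸ Rmap_mem_convexHull h))

theorem Rmap_iterate_four (p : Pt) : Rmap (Rmap (Rmap (Rmap p))) = p := by
  simp [Rmap]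

theorem Rmap_mem_unitSq {p : Pt} (hp : p ∈ unitSq) : Rmap p ∈ unitSq := by
  obtain ⟨⟨h1, h2⟩, h3, h4⟩ := hp
  exact ⟨⟨by simp only [Rmap]; linarith, by simp only [Rmap]; linarith⟩, h1, h2⟩

/-- The sector at the centre of the square spanned by `P₁` and `P₂`. -/
def Sector (s t : ℝ) (p : Pt) : Prop :=
  0 ≤ cross (1 / 2, 1 / 2) (s, t) p ∧ 0 ≤ cross (1 / 2, 1 / 2) p (1 - t, s)

theorem Sector.covered {s t : ℝ} (ht : 0 < t) (hts : t < s) (hs : s < 1 / 2)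
    (hst : s ^ 2 = t - t ^ 2) {p : Pt} (hp : p ∈ unitSq) (h : Sector s t p) :
    Covered s t p := by
  obtain ⟨⟨hx0, hx1⟩, hy0, hy1⟩ := hp
  obtain ⟨x, y⟩ := p
  obtain ⟨hu, hv⟩ := h
  by_cases hm : 0 ≤ cross (1, 0) (s, t) (x, y)
  · refine Or.inl ⟨0, mem_convexHull_of_cross (a := (0, 0)) (b := (1, 0)) (c := (s, t)) ?_ ?_ hm ?_⟩
      <;> simp only [cross] at *
    · linarith
    · linarith
    · refine nonneg_of_mul_nonneg_right (a := 1 - s - t) ?_ (by linarith)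
      linear_combination 2 * mul_nonneg ht.le hu + mul_nonneg (sub_nonneg.2 hts.le) hm
  by_cases hl : 0 ≤ cross (1 - t, s) (1, 0) (x, y)
  · refine Or.inl ⟨1, mem_convexHull_of_cross (a := (1, 0)) (b := (1, 1)) (c := (1 - t, s))
      ?_ ?_ ?_ hl⟩ <;> simp only [cross] at *
    · linarith
    · linarith
    · refine nonneg_of_mul_nonneg_right (a := s - t) ?_ (by linarith)
      linear_combination 2 * mul_nonneg ht.le hv +
        mul_nonneg (show 0 ≤ 1 - s - t by linarith) hl
  by_cases hc : 0 ≤ cross (s, t) (1 - t, s) (x, y)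
  · refine Or.inr (Or.inr (convexHull_mono (s := {Ppt s t 0, Ppt s t 1, Ppt s t 2}) ?_
      (mem_convexHull_of_cross (a := (s, t)) (b := (1 - t, s)) (c := (1 - s, 1 - t)) ?_ hc ?_ ?_)))
    · intro z; simp only [mem_insert_iff, mem_singleton_iff]; tauto
    all_goals simp only [cross] at *
    · nlinarith [sq_pos_of_pos (sub_pos.2 hs), sq_nonneg (1 / 2 - t)]
    · linear_combination hc + 2 * hv
    · linear_combination 2 * hu
  · refine Or.inr (Or.inl ⟨1, mem_convexHull_of_cross (a := (1, 0)) (b := (1 - t, s)) (c := (s, t))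
      ?_ ?_ ?_ ?_⟩) <;> simp only [cross] at *
    all_goals linarith

theorem covered_of_mem_unitSq {s t : ℝ} (ht : 0 < t) (hts : t < s) (hs : s < 1 / 2)
    (hst : s ^ 2 = t - t ^ 2) {p : Pt} (hp : p ∈ unitSq) : Covered s t p := by
  have hp1 := Rmap_mem_unitSq hp
  have hp2 := Rmap_mem_unitSq hp1
  have hp3 := Rmap_mem_unitSq hp2
  rcases le_total 0 (cross (1 / 2, 1 / 2) (s, t) p) with hu | hu <;>
  rcases le_total 0 (cross (1 / 2, 1 / 2) p (1 - t, s)) with hv | hv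
  · exact Sector.covered ht hts hs hst hp ⟨hu, hv⟩
  · have := (Sector.covered ht hts hs hst hp3 (by
      simp only [cross, Rmap, Sector] at *; constructor <;> linarith)).rotate
    rwa [Rmap_iterate_four] at this
  · have := (Sector.covered ht hts hs hst hp1 (by
      simp only [cross, Rmap, Sector] at *; constructor <;> linarith)).rotate.rotate.rotate
    rwa [Rmap_iterate_four] at this
  · have := (Sector.covered ht hts hs hst hp2 (by
      simp only [cross, Rmap, Sector] at *; constructor <;> linarith)).rotate.rotate
    rwa [Rmap_iterate_four] at this

/-- `F` commutes with the rotation `R` by `π/2` about the centre of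
the square: `F (R p) = R (F p)` for every `p ∈ Q`. -/
theorem square_map_commutes_with_rotation (θ : ℝ) (hθ : θ ∈ Ioo 0 (π/4))
    (t s : ℝ) (ht : t = sin θ ^ 2) (hs : s = sin θ * cos θ)
    (F : Pt → Pt) (hF : IsPAMap s t F) :
    ∀ p ∈ unitSq, F (Rmap p) = Rmap (F p) := by
  obtain ⟨-, -, hA, hB, ⟨g, hC⟩, hE, hP⟩ := hF
  have hEc : ∀ i, F (Rmap (Ept i)) = Rmap (F (Ept i)) := fun i => by
    rw [Rmap_Ept, hE, hE, Rmap_Ept]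
  have hPc : ∀ i, F (Rmap (Ppt s t i)) = Rmap (F (Ppt s t i)) := fun i => by
    rw [Rmap_Ppt, hP, hP, Rmap_Ppt']
  have hsin : 0 < sin θ := sin_pos_of_pos_of_lt_pi hθ.1 (by linarith [hθ.2, pi_pos])
  have hlt : sin θ < cos θ := by
    rw [← sin_pi_div_two_sub]
    exact sin_lt_sin_of_lt_of_le_pi_div_two (by linarith [hθ.1, pi_pos])
      (by linarith [hθ.1]) (by linarith [hθ.2])
  have hsc := sin_sq_add_cos_sq θ
  have ht0 : 0 < t := by rw [ht]; positivity
  have hts : t < s := by rw [ht, hs, sq]; exact mul_lt_mul_of_pos_left hlt hsin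
  have hs2 : s < 1 / 2 := by rw [hs]; nlinarith [sq_pos_of_pos (sub_pos.2 hlt)]
  have hst : s ^ 2 = t - t ^ 2 := by
    rw [ht, hs]; linear_combination sin θ ^ 2 * hsc
  intro p hp
  rcases covered_of_mem_unitSq ht0 hts hs2 hst hp with ⟨i, h⟩ | ⟨i, h⟩ | h
  · obtain ⟨g, hg⟩ := hA i
    obtain ⟨g', hg'⟩ := hA (i + 1)
    refine commutes_on_convexHull hg (convexHull_Rmap_A s t i ▸ hg') ?_ h
    rintro v (rfl | rfl | rfl)
    exacts [hEc _, hEc _, hPc _]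
  · obtain ⟨g, hg⟩ := hB i
    obtain ⟨g', hg'⟩ := hB (i + 1)
    refine commutes_on_convexHull hg (convexHull_Rmap_B s t i ▸ hg') ?_ h
    rintro v (rfl | rfl | rfl)
    exacts [hEc _, hPc _, hPc _]
  · refine commutes_on_convexHull hC (convexHull_Rmap_C s t ▸ hC) ?_ h
    rintro v (rfl | rfl | rfl | rfl)
    exacts [hPc _, hPc _, hPc _, hPc _]
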